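/- For every n and every k with 0 ≤ k ≤ n, the union ⋃_{x ∈ ψ k n} geom x (with the subspace topology from Fin n → ℝ) is homeomorphic to the closed unit ball Metric.closedBall (0 : EuclideanSpace ℝ (Fin k)) 1, and likewise the union ⋃_{x ∈ ω k n} geom x is homeomorphic to the closed unit ball in EuclideanSpace ℝ (Fin k); i.e., identifying the elements of either face collection along common boundaries produces a k-dimensional disk. -/

import Mathlib

/-- The geometric realization of a sub-cube word `x : Fin n → SignType`
as a face of the cube `[-1,1]^n ⊆ (Fin n → ℝ)`. -/
def geom {n : ℕ} (x : Fin n → SignType) : Set (Fin n → ℝ) :=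
  {p | ∀ i, (x i = 0 → p i ∈ Set.Icc (-1 : ℝ) 1) ∧ (x i ≠ 0 → p i = (x i : ℝ))}

/-- The dimension of a sub-cube: the number of `0` letters. -/
def dim {n : ℕ} (x : Fin n → SignType) : ℕ :=
  (Finset.univ.filter fun i => x i = 0).card

/-- The zero-set of a word. -/
def zeroSet {n : ℕ} (x : Fin n → SignType) : Finset (Fin n) :=
  Finset.univ.filter fun i => x i = 0

/-- Append the letter `s` at the end of a word (`λ`, `μ`, `ν` are `app (-1)`, `app 0`, `app 1`). -/
def app {n : ℕ} (s : SignType) (x : Fin n → SignType) : Fin (n + 1) → SignType :=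
  Fin.snoc x s

/-- The source `k`-faces `ψ k n` of the `n`-cube. -/
def Psi : (k n : ℕ) → Finset (Fin n → SignType)
  | _, 0 => {fun i => i.elim0}
  | 0, _ + 1 => {fun _ => -1}
  | k + 1, n + 1 =>
    if n + 1 ≤ k + 1 then {fun _ => 0}
    else if Even (k + 1) then
      (Psi k n).image (app 0) ∪ (Psi (k + 1) n).image (app (-1))
    else
      (Psi k n).image (app 0) ∪ (Psi (k + 1) n).image (app 1)

/-- The target `k`-faces `ω k n` of the `n`-cube. -/
def Omega : (k n : ℕ) → Finset (Fin n → SignType)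
  | _, 0 => {fun i => i.elim0}
  | 0, _ + 1 => {fun _ => 1}
  | k + 1, n + 1 =>
    if n + 1 ≤ k + 1 then {fun _ => 0}
    else if Even (k + 1) then
      (Omega (k + 1) n).image (app 1) ∪ (Omega k n).image (app 0)
    else
      (Omega (k + 1) n).image (app (-1)) ∪ (Omega k n).image (app 0)

/-- `HasChain R m p` says that `p` has a subsequence of length `m` whose `j`-th entry
satisfies `R j`. -/
def HasChain (R : ℕ → ℝ → Prop) : (m : ℕ) → {n : ℕ} → (Fin n → ℝ) → Prop
  | 0, _, _ => True
  | _ + 1, 0, _ => False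
  | m + 1, _ + 1, p =>
    HasChain R (m + 1) (Fin.init p) ∨ (HasChain R m (Fin.init p) ∧ R m (p (Fin.last _)))

namespace HasChain

variable {R S : ℕ → ℝ → Prop}

theorem pred {m n : ℕ} {p : Fin n → ℝ} (h : HasChain R (m + 1) p) : HasChain R m p := by
  induction n generalizing m with
  | zero => exact h.elim
  | succ n ih =>
    rcases m with _ | m
    · trivial
    · rcases h with h | ⟨h, -⟩
      · exact Or.inl (ih h)
      · exact Or.inl h

theorem length_le {m n : ℕ} {p : Fin n → ℝ} (h : HasChain R m p) : m ≤ n := by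
  induction n generalizing m with
  | zero =>
    rcases m with _ | m
    · rfl
    · exact h.elim
  | succ n ih =>
    rcases m with _ | m
    · exact Nat.zero_le _
    · rcases h with h | ⟨h, -⟩
      · exact (ih h).trans n.le_succ
      · exact Nat.succ_le_succ (ih h)

theorem one_iff {n : ℕ} {p : Fin n → ℝ} : HasChain R 1 p ↔ ∃ i, R 0 (p i) := by
  induction n with
  | zero => simp [HasChain]
  | succ n ih => simp [HasChain, ih, Fin.exists_fin_succ', Fin.init]

theorem mono {m n : ℕ} {p q : Fin n → ℝ} (hRS : ∀ j i, R j (p i) → S j (q i))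
    (h : HasChain R m p) : HasChain S m q := by
  induction n generalizing m with
  | zero =>
    rcases m with _ | m
    · trivial
    · exact h.elim
  | succ n ih =>
    have ih' : ∀ {m}, HasChain R m (Fin.init p) → HasChain S m (Fin.init q) :=
      ih fun j i => hRS j i.castSucc
    rcases m with _ | m
    · trivial
    · rcases h with h | ⟨h, hl⟩
      · exact Or.inl (ih' h)
      · exact Or.inr ⟨ih' h, hRS _ _ hl⟩

end HasChain

/-- Entries that can be decreased (even `j`) or increased (odd `j`) within `[-1, 1]`. -/
def Movable (j : ℕ) (v : ℝ) : Prop :=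
  if Even j then -1 < v else v < 1

/-- The alternating sign conditions, starting with the sign of `s`. -/
def Alternates (s : ℝ) (j : ℕ) (v : ℝ) : Prop :=
  0 < s * (-1) ^ j * v

theorem mem_geom_app {n : ℕ} (s : SignType) (x : Fin n → SignType) (p : Fin (n + 1) → ℝ) :
    p ∈ geom (app s x) ↔ Fin.init p ∈ geom x ∧
      (s = 0 → p (Fin.last n) ∈ Set.Icc (-1 : ℝ) 1) ∧ (s ≠ 0 → p (Fin.last n) = (s : ℝ)) := by
  simp [geom, app, Fin.forall_fin_succ', Fin.init]

theorem mem_iUnion_Psi_iff {n : ℕ} (k : ℕ) (p : Fin n → ℝ) :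
    p ∈ ⋃ x ∈ Psi k n, geom x ↔
      (∀ i, p i ∈ Set.Icc (-1 : ℝ) 1) ∧ ¬ HasChain Movable (k + 1) p := by
  induction n generalizing k with
  | zero => simp [Psi, geom, HasChain]
  | succ n ih =>
    rcases k with _ | k
    · rw [zero_add, HasChain.one_iff]
      simp only [Psi, geom, Movable, Finset.mem_singleton, Set.iUnion_iUnion_eq_left,
        Set.mem_ofPred_eq, Set.mem_Icc, not_exists, Even.zero, if_true, not_lt, ← forall_and]
      refine forall_congr' fun i => ?_
      simp
      constructor
      · intro h; norm_num [h]
      · intro h; linarith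
    · by_cases hk : n ≤ k
      · have hc : ¬ HasChain Movable (k + 1 + 1) p := fun h => by
          have := h.length_le
          omega
        simp [Psi, hk, geom, hc]
      · have key : p ∈ ⋃ x ∈ Psi (k + 1) (n + 1), geom x ↔
            ((Fin.init p ∈ ⋃ x ∈ Psi k n, geom x) ∧ p (Fin.last n) ∈ Set.Icc (-1 : ℝ) 1) ∨
            ((Fin.init p ∈ ⋃ x ∈ Psi (k + 1) n, geom x) ∧
              p (Fin.last n) ∈ Set.Icc (-1 : ℝ) 1 ∧ ¬ Movable (k + 1) (p (Fin.last n))) := by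
          have h1 : ∀ v : ℝ, v ∈ Set.Icc (-1 : ℝ) 1 ∧ v ≤ -1 ↔ v = -1 := fun v =>
            ⟨fun h => le_antisymm h.2 h.1.1, by rintro rfl; norm_num⟩
          have h2 : ∀ v : ℝ, v ∈ Set.Icc (-1 : ℝ) 1 ∧ 1 ≤ v ↔ v = 1 := fun v =>
            ⟨fun h => le_antisymm h.1.2 h.2, by rintro rfl; norm_num⟩
          by_cases he : Even (k + 1)
          · simp only [Psi, add_le_add_iff_right, hk, he, if_true, if_false, Movable, not_lt, h1]
            simp [or_and_right, exists_or, mem_geom_app, ← exists_and_right, and_assoc]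
          · simp only [Psi, add_le_add_iff_right, hk, he, if_false, Movable, not_lt, h2]
            simp [or_and_right, exists_or, mem_geom_app, ← exists_and_right, and_assoc]
        rw [key, ih, ih, HasChain, Fin.forall_fin_succ']
        have := @HasChain.pred Movable (k + 1) n (Fin.init p)
        simp only [Fin.init] at this ⊢
        tauto

theorem app_neg {n : ℕ} (s : SignType) (x : Fin n → SignType) : app (-s) (-x) = -app s x := by
  ext i
  refine Fin.lastCases ?_ (fun i => ?_) i <;> simp [app]

theorem Omega_eq_image_neg (k n : ℕ) : Omega k n = (Psi k n).image (fun x => -x) := by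
  induction n generalizing k with
  | zero =>
    rw [Omega, Psi, Finset.image_singleton]
    congr 1
    exact Subsingleton.elim _ _
  | succ n ih =>
    rcases k with _ | k
    · simp only [Omega, Psi, Finset.image_singleton]
      congr 1
    · have h (s : SignType) : (fun x : Fin n → SignType => app s (-x)) =
          fun x => -app (-s) x := by
        ext1 x
        rw [← app_neg, neg_neg]
      rw [Omega, Psi]
      split_ifs
      · rw [Finset.image_singleton]
        congr 1
      · simp [ih, Finset.image_union, Finset.image_image, Function.comp_def, h, Finset.union_comm]
      · simp [ih, Finset.image_union, Finset.image_image, Function.comp_def, h, Finset.union_comm]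

theorem mem_geom_neg_iff {n : ℕ} (x : Fin n → SignType) (p : Fin n → ℝ) :
    p ∈ geom (-x) ↔ -p ∈ geom x := by
  refine forall_congr' fun i => ?_
  rcases hx : x i <;> simp [hx, neg_eq_iff_eq_neg, and_comm, neg_le]

/-- If `d` has few sign changes, then some polynomial of low degree has the same signs as `d`
at the nodes. -/
theorem exists_polynomial_of_not_hasChain {n : ℕ} {s : ℝ} (hs : s ^ 2 = 1) (m : ℕ)
    (d : Fin n → ℝ) (h : ¬ HasChain (Alternates s) (m + 1) d) :
    ∃ q : Polynomial ℝ, q.natDegree ≤ m ∧ s * (-1) ^ m * q.coeff m ≤ 0 ∧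
      (∀ i, d i ≠ 0 → 0 < q.eval (i : ℝ) * d i) ∧
      ∀ N : ℕ, n ≤ N → s * (-1) ^ m * q.eval (N : ℝ) < 0 := by
  have hsq (m : ℕ) : (s * (-1) ^ m) * (s * (-1) ^ m) = 1 := by
    rw [← pow_two, mul_pow, hs, ← pow_mul, mul_comm m, pow_mul]
    norm_num
  induction n generalizing m with
  | zero =>
    have hp := hsq m
    refine ⟨Polynomial.C (-(s * (-1) ^ m)), (Polynomial.natDegree_C _).le.trans m.zero_le, ?_,
      fun i => i.elim0, fun N _ => ?_⟩
    · rw [Polynomial.coeff_C]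
      split_ifs <;> linarith
    · rw [Polynomial.eval_C]; linarith
  | succ n ih =>
    rw [HasChain, not_or] at h
    by_cases hl : Alternates s m (d (Fin.last n))
    · rcases m with _ | m
      · exact absurd ⟨by simp [HasChain], hl⟩ h.2
      · obtain ⟨q, hdeg, hc, hpos, hN⟩ := ih m (Fin.init d) fun hh => h.2 ⟨hh, hl⟩
        refine ⟨q * (Polynomial.C (n + 1 / 2 : ℝ) - Polynomial.X), ?_, ?_, ?_, ?_⟩
        · refine Polynomial.natDegree_mul_le.trans (add_le_add hdeg ?_)
          exact (Polynomial.natDegree_sub_le _ _).trans (by simp)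
        · rw [mul_sub, Polynomial.coeff_sub, Polynomial.coeff_mul_C, Polynomial.coeff_mul_X,
            Polynomial.coeff_eq_zero_of_natDegree_lt (by omega)]
          rw [pow_succ]; linarith
        · refine Fin.lastCases ?_ fun i => ?_
          · intro _
            have h1 := hN n le_rfl
            unfold Alternates at hl
            simp only [Polynomial.eval_mul, Polynomial.eval_sub, Polynomial.eval_C,
              Polynomial.eval_X, Fin.val_last]
            rw [pow_succ] at hl
            have h2 := hsq m
            set a := s * (-1) ^ m
            have h3 : a * d (Fin.last n) < 0 := by linarith
            have h4 := mul_pos_of_neg_of_neg h1 h3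
            have h5 : a * q.eval (n : ℝ) * (a * d (Fin.last n)) =
              (a * a) * (q.eval (n : ℝ) * d (Fin.last n)) := by ring
            rw [h5, h2] at h4
            linarith
          · intro hi
            have h1 := hpos i hi
            have h2 : ((i : ℕ) : ℝ) < n := by exact_mod_cast i.2
            simp only [Polynomial.eval_mul, Polynomial.eval_sub, Polynomial.eval_C,
              Polynomial.eval_X, Fin.val_castSucc]
            rw [mul_right_comm]
            exact mul_pos h1 (by linarith)
        · intro N hnN
          have h1 := hN N (by omega)
          have h2 : (n : ℝ) + 1 ≤ N := by exact_mod_cast hnN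
          simp only [Polynomial.eval_mul, Polynomial.eval_sub, Polynomial.eval_C,
            Polynomial.eval_X]
          have h3 : (n : ℝ) + 1 / 2 - N < 0 := by linarith
          have := mul_pos_of_neg_of_neg h1 h3
          rw [pow_succ]; linarith
    · obtain ⟨q, hdeg, hc, hpos, hN⟩ := ih m (Fin.init d) h.1
      refine ⟨q, hdeg, hc, ?_, fun N hnN => hN N (by omega)⟩
      refine Fin.lastCases ?_ fun i hi => hpos i hi
      intro hd
      have h1 := hN n le_rfl
      unfold Alternates at hl
      rw [not_lt] at hl
      have h2 := mul_nonneg_of_nonpos_of_nonpos h1.le hl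
      have h3 : s * (-1) ^ m * q.eval (n : ℝ) * (s * (-1) ^ m * d (Fin.last n)) =
          (s * (-1) ^ m) * (s * (-1) ^ m) * (q.eval (n : ℝ) * d (Fin.last n)) := by ring
      rw [h3, hsq, one_mul] at h2
      refine lt_of_le_of_ne h2 (Ne.symm (mul_ne_zero ?_ hd))
      intro h0
      rw [Fin.val_last] at h0
      rw [h0] at h1
      simp at h1

/-- The `j`-th moment of `d` with respect to the nodes `0, …, n - 1`. -/
def moment {n : ℕ} (j : ℕ) (d : Fin n → ℝ) : ℝ :=
  ∑ i : Fin n, (i : ℝ) ^ j * d i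

theorem sum_eval_mul_eq_coeff_mul_moment {n k : ℕ} {d : Fin n → ℝ} (q : Polynomial ℝ)
    (hq : q.natDegree ≤ k) (hd : ∀ j < k, moment j d = 0) :
    ∑ i : Fin n, q.eval (i : ℝ) * d i = q.coeff k * moment k d := by
  have h : ∑ i : Fin n, q.eval (i : ℝ) * d i =
      ∑ j ∈ Finset.range (k + 1), q.coeff j * moment j d := by
    simp_rw [moment, Finset.mul_sum]
    rw [Finset.sum_comm]
    refine Finset.sum_congr rfl fun i _ => ?_
    rw [Polynomial.eval_eq_sum_range' (Nat.lt_succ_of_le hq), Finset.sum_mul]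
    exact Finset.sum_congr rfl fun j _ => mul_assoc _ _ _
  rw [h, Finset.sum_range_succ, Finset.sum_eq_zero, zero_add]
  intro j hj
  rw [hd j (Finset.mem_range.1 hj), mul_zero]

/-- A nonzero vector whose moments of order `< k` vanish has at least `k` sign changes. -/
theorem eq_zero_of_moment_eq_zero {n k : ℕ} {d : Fin n → ℝ} (hd : ∀ j < k, moment j d = 0)
    (h₁ : ¬ HasChain (Alternates 1) (k + 1) d) (h₂ : ¬ HasChain (Alternates (-1)) (k + 1) d) :
    d = 0 := by
  obtain ⟨q, hq, hqc, hqd, -⟩ := exists_polynomial_of_not_hasChain (by norm_num) k d h₁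
  obtain ⟨r, hr, hrc, hrd, -⟩ := exists_polynomial_of_not_hasChain (by norm_num) k d h₂
  by_contra hne
  obtain ⟨i₀, hi₀⟩ := Function.ne_iff.1 hne
  have pos : ∀ f : Polynomial ℝ, f.natDegree ≤ k →
      (∀ i, d i ≠ 0 → 0 < f.eval ((i : ℕ) : ℝ) * d i) → 0 < f.coeff k * moment k d := by
    intro f hf hfd
    rw [← sum_eval_mul_eq_coeff_mul_moment f hf hd]
    refine Finset.sum_pos' (fun i _ => ?_) ⟨i₀, Finset.mem_univ _, hfd i₀ hi₀⟩
    by_cases hi : d i = 0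
    · simp [hi]
    · exact (hfd i hi).le
  have hq' := pos q hq hqd
  have hr' := pos r hr hrd
  rcases neg_one_pow_eq_or ℝ k with h | h <;> rw [h] at hqc hrc <;>
    rcases le_total 0 (moment k d) with hm | hm <;> nlinarith

/-- A chain of movable entries yields a direction which stays in the cube, preserves the moments
of order `< m` and decreases `(-1) ^ m` times the `m`-th one. -/
theorem exists_direction_of_hasChain {n : ℕ} (m : ℕ) (p : Fin n → ℝ)
    (h : HasChain Movable (m + 1) p) :
    ∃ d : Fin n → ℝ, (∀ j < m, moment j d = 0) ∧ (-1) ^ m * moment m d < 0 ∧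
      (∀ i, d i < 0 → -1 < p i) ∧ (∀ i, 0 < d i → p i < 1) ∧
      ∀ N : ℕ, n ≤ N → (-1) ^ m * ∑ i, d i / ((N : ℝ) - (i : ℕ)) < 0 := by
  induction n generalizing m with
  | zero => exact h.elim
  | succ n ih =>
    have snoc_moment (j : ℕ) (d : Fin n → ℝ) (a : ℝ) :
        moment j (Fin.snoc d a : Fin (n + 1) → ℝ) = moment j d + (n : ℝ) ^ j * a := by
      simp [moment, Fin.sum_univ_castSucc]
    rcases h with h | ⟨h, hl⟩
    · obtain ⟨d, h1, h2, h3, h4, h5⟩ := ih m _ h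
      refine ⟨Fin.snoc d 0, ?_, ?_, ?_, ?_, fun N hN => ?_⟩
      · simpa [snoc_moment] using h1
      · simpa [snoc_moment] using h2
      · simpa [Fin.forall_fin_succ', Fin.init] using h3
      · simpa [Fin.forall_fin_succ', Fin.init] using h4
      · simpa [Fin.sum_univ_castSucc] using h5 N (by omega)
    rcases m with _ | m
    · simp only [Movable, Even.zero, if_true] at hl
      refine ⟨Fin.snoc 0 (-1), ?_, ?_, ?_, ?_, fun N hN => ?_⟩
      · simp
      · simp [moment]
      · simpa [Fin.forall_fin_succ'] using hl
      · simp [Fin.forall_fin_succ']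
      · have : (n : ℝ) + 1 ≤ N := by exact_mod_cast hN
        simp only [Fin.sum_univ_castSucc, Fin.snoc_castSucc, Fin.snoc_last]
        simpa using div_neg_of_neg_of_pos (by norm_num) (by linarith)
    obtain ⟨d, h1, h2, h3, h4, h5⟩ := ih m _ h
    have hpos (i : Fin n) : (0 : ℝ) < n - (i : ℕ) := by
      have : ((i : ℕ) : ℝ) < n := by exact_mod_cast i.2
      linarith
    set e : Fin n → ℝ := fun i => d i / ((n : ℝ) - (i : ℕ)) with he
    have moment_zero : moment 0 (Fin.snoc e (-∑ i, e i) : Fin (n + 1) → ℝ) = 0 := by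
      rw [snoc_moment]; simp [moment]
    have moment_succ (j : ℕ) : moment (j + 1) (Fin.snoc e (-∑ i, e i) : Fin (n + 1) → ℝ) =
        n * moment j (Fin.snoc e (-∑ i, e i) : Fin (n + 1) → ℝ) - moment j d := by
      rw [snoc_moment, snoc_moment]
      have : moment (j + 1) e = n * moment j e - moment j d := by
        simp only [moment, Finset.mul_sum, ← Finset.sum_sub_distrib]
        refine Finset.sum_congr rfl fun i _ => ?_
        have := (hpos i).ne'
        simp only [he]
        field_simp
        ring
      rw [this]; ring
    have moment_lt : ∀ j < m + 1, moment j (Fin.snoc e (-∑ i, e i) : Fin (n + 1) → ℝ) = 0 := by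
      intro j
      induction j with
      | zero => exact fun _ => moment_zero
      | succ j ihj =>
        intro hj
        rw [moment_succ, ihj (by omega), h1 j (by omega)]
        ring
    have hsum := h5 n le_rfl
    refine ⟨Fin.snoc e (-∑ i, e i), moment_lt, ?_, ?_, ?_, fun N hN => ?_⟩
    · rw [moment_succ, moment_lt m m.lt_succ_self, pow_succ]
      linarith
    · refine Fin.lastCases ?_ fun i => ?_
      · rw [Fin.snoc_last]
        intro hneg
        by_contra hp
        unfold Movable at hl
        split_ifs at hl with hev
        · exact hp hl
        · rw [(by grind : Even m).neg_one_pow] at hsum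
          linarith
      · rw [Fin.snoc_castSucc]
        intro hneg
        refine h3 i (not_le.1 fun hd => absurd hneg (not_lt.2 ?_))
        exact div_nonneg hd (hpos i).le
    · refine Fin.lastCases ?_ fun i => ?_
      · rw [Fin.snoc_last]
        intro hneg
        by_contra hp
        unfold Movable at hl
        split_ifs at hl with hev
        · rw [(by grind : Odd m).neg_one_pow] at hsum
          linarith
        · exact hp hl
      · rw [Fin.snoc_castSucc]
        intro hneg
        refine h4 i (not_le.1 fun hd => absurd hneg (not_lt.2 ?_))
        exact div_nonpos_of_nonpos_of_nonneg hd (hpos i).le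
    · have h6 := h5 N (by omega)
      have hNn : (0 : ℝ) < N - n := by
        have : (n : ℝ) + 1 ≤ N := by exact_mod_cast hN
        linarith
      have h7 : ∑ i, (Fin.snoc e (-∑ i, e i) : Fin (n + 1) → ℝ) i / ((N : ℝ) - (i : ℕ)) =
          - (∑ i, d i / ((N : ℝ) - (i : ℕ))) / (N - n) := by
        simp only [Fin.sum_univ_castSucc, Fin.snoc_castSucc, Fin.snoc_last, Fin.val_castSucc,
          Fin.val_last]
        rw [neg_div, neg_div, ← sub_eq_add_neg, Finset.sum_div, Finset.sum_div,
          ← Finset.sum_sub_distrib, ← Finset.sum_neg_distrib]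
        refine Finset.sum_congr rfl fun i _ => ?_
        have h8 := (hpos i).ne'
        have h9 : (N : ℝ) - (i : ℕ) ≠ 0 := by linarith [hpos i]
        simp only [he]
        field_simp
        ring
      rw [h7, pow_succ]
      have := div_neg_of_neg_of_pos h6 hNn
      calc _ = _ := by ring
        _ < 0 := this

theorem not_hasChain_alternates_sub {n k : ℕ} {p q : Fin n → ℝ}
    (hp : ∀ i, p i ∈ Set.Icc (-1 : ℝ) 1) (hq : ∀ i, q i ∈ Set.Icc (-1 : ℝ) 1)
    (h : ¬ HasChain Movable k p) : ¬ HasChain (Alternates 1) k (p - q) := by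
  refine fun hc => h (hc.mono fun j i hij => ?_)
  have h1 := hp i
  have h2 := hq i
  simp only [Set.mem_Icc] at h1 h2
  unfold Alternates at hij
  unfold Movable
  rw [Pi.sub_apply] at hij
  split_ifs with hj
  · rw [hj.neg_one_pow] at hij
    linarith
  · rw [(Nat.not_even_iff_odd.1 hj).neg_one_pow] at hij
    linarith

/-- The linear map recording the moments of order `< k`; it maps the cube onto a cyclic zonotope. -/
noncomputable def momentMap (n k : ℕ) : (Fin n → ℝ) →ₗ[ℝ] EuclideanSpace ℝ (Fin k) where
  toFun p := WithLp.toLp 2 fun j => moment j p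
  map_add' p q := by
    ext j
    simp [moment, mul_add, Finset.sum_add_distrib]
  map_smul' c p := by
    ext j
    simp [moment, Finset.mul_sum, mul_left_comm]

theorem momentMap_eq_iff {n k : ℕ} {p q : Fin n → ℝ} :
    momentMap n k p = momentMap n k q ↔ ∀ j < k, moment j (p - q) = 0 := by
  rw [← sub_eq_zero, ← map_sub]
  constructor
  · intro h j hj
    simpa [momentMap] using congrArg (fun v => v ⟨j, hj⟩) h
  · intro h
    ext j
    simpa [momentMap] using h j j.2

theorem injOn_momentMap (n k : ℕ) : Set.InjOn (momentMap n k) (⋃ x ∈ Psi k n, geom x) := by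
  intro p hp q hq hpq
  rw [mem_iUnion_Psi_iff] at hp hq
  rw [← sub_eq_zero]
  refine eq_zero_of_moment_eq_zero (momentMap_eq_iff.1 hpq)
    (not_hasChain_alternates_sub hp.1 hq.1 hp.2) fun h => ?_
  refine not_hasChain_alternates_sub hq.1 hp.1 hq.2 (h.mono fun j i hij => ?_)
  unfold Alternates at *
  rw [Pi.sub_apply] at *
  linarith

theorem continuous_momentMap (n k : ℕ) : Continuous (momentMap n k) :=
  (momentMap n k).continuous_of_finiteDimensional

theorem continuous_moment {n : ℕ} (j : ℕ) : Continuous (moment j : (Fin n → ℝ) → ℝ) := by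
  unfold moment
  fun_prop

theorem image_momentMap_iUnion_Psi (n k : ℕ) :
    momentMap n k '' (⋃ x ∈ Psi k n, geom x) =
      momentMap n k '' Set.univ.pi fun _ => Set.Icc (-1 : ℝ) 1 := by
  apply Set.Subset.antisymm
  · refine Set.image_mono fun p hp => ?_
    exact fun i _ => ((mem_iUnion_Psi_iff k p).1 hp).1 i
  rintro _ ⟨p, hp, rfl⟩
  have hcube : IsCompact (Set.univ.pi fun _ : Fin n => Set.Icc (-1 : ℝ) 1) :=
    isCompact_univ_pi fun _ => isCompact_Icc
  have hfib : IsCompact ((Set.univ.pi fun _ : Fin n => Set.Icc (-1 : ℝ) 1) ∩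
      momentMap n k ⁻¹' {momentMap n k p}) :=
    hcube.inter_right (isClosed_singleton.preimage (continuous_momentMap n k))
  obtain ⟨q, ⟨hq, hqp⟩, hmin⟩ := hfib.exists_isMinOn ⟨p, hp, rfl⟩
    ((continuous_moment k).const_mul ((-1) ^ k)).continuousOn
  refine ⟨q, (mem_iUnion_Psi_iff k q).2 ⟨fun i => hq i trivial, fun hc => ?_⟩, hqp⟩
  obtain ⟨d, hd, hdk, hlo, hhi, -⟩ := exists_direction_of_hasChain k q hc
  have hev : ∀ᶠ ε in nhdsWithin (0 : ℝ) (Set.Ioi 0), ∀ i, q i + ε * d i ∈ Set.Icc (-1 : ℝ) 1 := by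
    refine Filter.eventually_all.2 fun i => ?_
    have hqi := hq i trivial
    have hcont : Filter.Tendsto (fun ε : ℝ => q i + ε * d i) (nhdsWithin 0 (Set.Ioi 0))
        (nhds (q i)) := by
      have : Continuous fun ε : ℝ => q i + ε * d i := by fun_prop
      simpa using (this.tendsto 0).mono_left nhdsWithin_le_nhds
    rcases lt_trichotomy (d i) 0 with hi | hi | hi
    · filter_upwards [hcont.eventually_const_lt (hlo i hi), self_mem_nhdsWithin] with ε h1 h2
      exact ⟨h1.le, by linarith [mul_neg_of_pos_of_neg h2 hi, hqi.2]⟩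
    · simpa [hi] using hqi
    · filter_upwards [hcont.eventually_lt_const (hhi i hi), self_mem_nhdsWithin] with ε h1 h2
      exact ⟨by linarith [mul_pos h2 hi, hqi.1], h1.le⟩
  obtain ⟨ε, hε, hε0⟩ := (hev.and self_mem_nhdsWithin).exists
  have moment_add (j : ℕ) : moment j (q + ε • d) = moment j q + ε * moment j d := by
    simp [moment, mul_add, Finset.sum_add_distrib, Finset.mul_sum, mul_left_comm]
  have hmem : q + ε • d ∈ (Set.univ.pi fun _ : Fin n => Set.Icc (-1 : ℝ) 1) ∩
      momentMap n k ⁻¹' {momentMap n k p} := by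
    refine ⟨fun i _ => hε i, ?_⟩
    rw [Set.mem_preimage, Set.mem_singleton_iff, ← Set.mem_singleton_iff.1 hqp]
    ext j
    simp [momentMap, moment_add, hd j j.2]
  have hle := isMinOn_iff.1 hmin _ hmem
  rw [moment_add] at hle
  have := mul_neg_of_pos_of_neg hε0 hdk
  linarith

theorem surjective_momentMap {n k : ℕ} (hk : k ≤ n) : Function.Surjective (momentMap n k) := by
  obtain ⟨m, rfl⟩ := Nat.exists_eq_add_of_le hk
  intro v
  have hdet : IsUnit (Matrix.vandermonde fun i : Fin k => ((i : ℕ) : ℝ)).transpose := by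
    rw [Matrix.isUnit_iff_isUnit_det, Matrix.det_transpose, isUnit_iff_ne_zero,
      Matrix.det_vandermonde_ne_zero_iff]
    intro i j hij
    exact Fin.ext (Nat.cast_injective hij)
  obtain ⟨w, hw⟩ := Matrix.mulVec_surjective_iff_isUnit.2 hdet v.ofLp
  refine ⟨Fin.append w 0, ?_⟩
  ext j
  have := congrFun hw j
  simpa [momentMap, moment, Fin.sum_univ_add, Matrix.mulVec, dotProduct,
    Matrix.vandermonde_apply] using this

theorem isCompact_geom {n : ℕ} (x : Fin n → SignType) : IsCompact (geom x) := by
  have h : geom x = Set.univ.pi fun i =>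
      if x i = 0 then Set.Icc (-1 : ℝ) 1 else {(x i : ℝ)} := by
    ext p
    simp only [geom, Set.mem_ofPred_eq, Set.mem_univ_pi]
    refine forall_congr' fun i => ?_
    by_cases hi : x i = 0 <;> simp [hi]
  rw [h]
  refine isCompact_univ_pi fun i => ?_
  split_ifs
  · exact isCompact_Icc
  · exact isCompact_singleton

theorem nonempty_homeomorph_closedBall_Psi {n k : ℕ} (hk : k ≤ n) :
    Nonempty ((⋃ x ∈ Psi k n, geom x) ≃ₜ
      (Metric.closedBall (0 : EuclideanSpace ℝ (Fin k)) 1)) := by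
  set A := ⋃ x ∈ Psi k n, geom x with hA
  have hAc : IsCompact A := (Psi k n).isCompact_biUnion fun x _ => isCompact_geom x
  have : CompactSpace A := isCompact_iff_compactSpace.1 hAc
  have hcont : Continuous (momentMap n k) := continuous_momentMap n k
  let e : A ≃ₜ (momentMap n k '' A) :=
    Continuous.homeoOfEquivCompactToT2
      (f := Equiv.Set.imageOfInjOn (momentMap n k) A (injOn_momentMap n k))
      ((hcont.comp continuous_subtype_val).subtype_mk _)
  have himage := image_momentMap_iUnion_Psi n k
  rw [← hA] at himage
  have hconv : Convex ℝ (momentMap n k '' A) := by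
    rw [himage]
    exact (convex_pi fun _ _ => convex_Icc _ _).linear_image _
  have hint : (interior (momentMap n k '' A)).Nonempty := by
    rw [himage]
    have hopen := (momentMap n k).isOpenMap_of_finiteDimensional (surjective_momentMap hk)
    refine Set.Nonempty.mono (hopen.image_interior_subset _) (Set.Nonempty.image _ ⟨0, ?_⟩)
    rw [interior_pi_set Set.finite_univ]
    intro i _
    rw [interior_Icc]
    norm_num
  have hcomp := hAc.image hcont
  obtain ⟨h, -, hball, -⟩ :=
    exists_homeomorph_image_interior_closure_frontier_eq_unitBall hconv hint hcomp.isBounded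
  rw [hcomp.isClosed.closure_eq] at hball
  exact ⟨e.trans ((h.image _).trans (Homeomorph.setCongr hball))⟩

theorem iUnion_Omega_eq_image_neg (k n : ℕ) :
    (⋃ x ∈ Omega k n, geom x) = Homeomorph.neg (Fin n → ℝ) '' ⋃ x ∈ Psi k n, geom x := by
  ext p
  rw [Omega_eq_image_neg]
  simp [mem_geom_neg_iff]

/-- Identifying the source (resp. target) `k`-faces along common boundaries produces a
`k`-dimensional disk. -/
theorem stmt_5 (n k : ℕ) (hk : k ≤ n) :
    Nonempty ((⋃ x ∈ Psi k n, geom x) ≃ₜ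
      (Metric.closedBall (0 : EuclideanSpace ℝ (Fin k)) 1)) ∧
    Nonempty ((⋃ x ∈ Omega k n, geom x) ≃ₜ
      (Metric.closedBall (0 : EuclideanSpace ℝ (Fin k)) 1)) := by
  obtain ⟨e⟩ := nonempty_homeomorph_closedBall_Psi hk
  refine ⟨⟨e⟩, ?_⟩
  rw [iUnion_Omega_eq_image_neg]
  exact ⟨((Homeomorph.neg (Fin n → ℝ)).image _).symm.trans e⟩
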